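/- arXiv:2311.10355 — 2 statements merged into one kernel-verified Lean document; each statement's English description precedes it below -/
import Mathlib

section
/- Let p > 0 and α ≤ p. Then there exist constants C₁, C₂ > 0, depending only on p and α, such that C₁ t^{(p+1)/p} (log(e+t))^{α/p} ≤ Ã(t) ≤ C₂ t^{(p+1)/p} (log(e+t))^{α/p} for all t ≥ 0. -/
open Real Set

/-- a(t) = t^p / (log(e+t))^α. -/
noncomputable def a (p α t : ℝ) : ℝ := t ^ p / Real.log (Real.exp 1 + t) ^ α

/-- Ã(t) = ∫₀ᵗ ã(s) ds, where ã is a given function (intended as a⁻¹). -/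
noncomputable def Atilde (atil : ℝ → ℝ) (t : ℝ) : ℝ := ∫ s in (0:ℝ)..t, atil s

theorem one_le_log_exp_one_add {x : ℝ} (hx : 0 ≤ x) : 1 ≤ Real.log (Real.exp 1 + x) := by
  rw [Real.le_log_iff_exp_le (by positivity)]
  linarith

theorem log_exp_one_add_mono {x y : ℝ} (hx : 0 ≤ x) (hxy : x ≤ y) :
    Real.log (Real.exp 1 + x) ≤ Real.log (Real.exp 1 + y) :=
  Real.log_le_log (by positivity) (by linarith)

theorem rpow_le_of_comparable {u v c : ℝ} (β : ℝ) (hu : 0 < u) (hv : 0 < v) (hc : 0 < c)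
    (huv : u ≤ c * v) (hvu : v ≤ c * u) : u ^ β ≤ c ^ |β| * v ^ β := by
  rcases le_or_gt 0 β with hβ | hβ
  · rw [abs_of_nonneg hβ, ← Real.mul_rpow hc.le hv.le]
    exact Real.rpow_le_rpow hu.le huv hβ
  · have h : (c * u) ^ β ≤ v ^ β := Real.rpow_le_rpow_of_nonpos hv hvu hβ.le
    rw [Real.mul_rpow hc.le hu.le] at h
    calc u ^ β = c ^ |β| * (c ^ β * u ^ β) := by
          rw [abs_of_neg hβ, ← mul_assoc, ← Real.rpow_add hc]; simp
      _ ≤ c ^ |β| * v ^ β := by gcongr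

/-- Concavity of the logarithm makes `log (e + x) / x` decreasing. -/
theorem mul_log_exp_one_add_le {x y : ℝ} (hx : 0 ≤ x) (hxy : x ≤ y) :
    x * Real.log (Real.exp 1 + y) ≤ y * Real.log (Real.exp 1 + x) := by
  rcases hx.eq_or_lt with rfl | hx
  · have := one_le_log_exp_one_add le_rfl
    nlinarith
  have hy : 0 < y := hx.trans_le hxy
  have h := strictConcaveOn_log_Ioi.concaveOn.2
    (Set.mem_Ioi.2 (by positivity : 0 < Real.exp 1))
    (Set.mem_Ioi.2 (by positivity : 0 < Real.exp 1 + y))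
    (sub_nonneg.2 ((div_le_one hy).2 hxy)) (by positivity : 0 ≤ x / y) (by ring)
  simp only [smul_eq_mul, Real.log_exp] at h
  have e : (1 - x / y) * Real.exp 1 + x / y * (Real.exp 1 + y) = Real.exp 1 + x := by
    field_simp
    ring
  rw [e] at h
  have h1 : 0 ≤ 1 - x / y := sub_nonneg.2 ((div_le_one hy).2 hxy)
  calc x * Real.log (Real.exp 1 + y) = y * (x / y * Real.log (Real.exp 1 + y)) := by
        field_simp
    _ ≤ y * Real.log (Real.exp 1 + x) := by
        gcongr
        linarith

theorem a_monotoneOn {p α : ℝ} (hp : 0 < p) (hα : α ≤ p) : MonotoneOn (a p α) (Set.Ici 0) := by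
  intro x hx y hy hxy
  simp only [Set.mem_Ici] at hx hy
  have hLx := one_le_log_exp_one_add hx
  have hLy := one_le_log_exp_one_add hy
  have hL := log_exp_one_add_mono hx hxy
  have hmul := mul_log_exp_one_add_le hx hxy
  unfold a
  set X := Real.log (Real.exp 1 + x)
  set Y := Real.log (Real.exp 1 + y)
  have hX : 0 < X := by linarith
  have hY : 0 < Y := by linarith
  rw [div_le_div_iff₀ (Real.rpow_pos_of_pos hX _) (Real.rpow_pos_of_pos hY _)]
  have h1 : (Y / X) ^ α ≤ (Y / X) ^ p :=
    Real.rpow_le_rpow_of_exponent_le ((one_le_div hX).2 hL) hα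
  have h2 : (x * (Y / X)) ^ p ≤ y ^ p := by
    refine Real.rpow_le_rpow (by positivity) ?_ hp.le
    rw [← mul_div_assoc, div_le_iff₀ hX]
    exact hmul
  calc x ^ p * Y ^ α = x ^ p * (Y / X) ^ α * X ^ α := by
        rw [Real.div_rpow hY.le hX.le]
        have := (Real.rpow_pos_of_pos hX α).ne'
        field_simp
    _ ≤ x ^ p * (Y / X) ^ p * X ^ α := by gcongr
    _ = (x * (Y / X)) ^ p * X ^ α := by rw [Real.mul_rpow hx (by positivity)]
    _ ≤ y ^ p * X ^ α := by gcongr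

theorem log_a_le {p α x : ℝ} (hp : 0 < p) (hx : 0 ≤ x) :
    Real.log (Real.exp 1 + a p α x) ≤ (p + |α| + 2) * Real.log (Real.exp 1 + x) := by
  have he : 2 ≤ Real.exp 1 := by linarith [Real.add_one_le_exp (1 : ℝ)]
  have hL := one_le_log_exp_one_add hx
  set y := Real.exp 1 + x with hy
  have hy2 : 2 ≤ y := by linarith
  have hLy : Real.log y ≤ y := Real.log_le_self (by linarith)
  have ha0 : 0 ≤ a p α x := by unfold a; positivity
  have ha : a p α x ≤ y ^ (p + |α|) := by
    unfold a
    rw [← hy, div_eq_mul_inv, ← Real.rpow_neg (by linarith), Real.rpow_add (by linarith)]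
    gcongr
    · linarith
    · calc Real.log y ^ (-α) ≤ Real.log y ^ |α| :=
            Real.rpow_le_rpow_of_exponent_le hL (neg_le_abs α)
        _ ≤ y ^ |α| := Real.rpow_le_rpow (by linarith) hLy (abs_nonneg α)
  have hmul : Real.exp 1 + a p α x ≤ y ^ (p + |α| + 2) := by
    have h1 : 1 ≤ y ^ (p + |α|) := Real.one_le_rpow (by linarith) (by positivity)
    rw [Real.rpow_add (by linarith : 0 < y), Real.rpow_two]
    nlinarith [mul_le_mul_of_nonneg_left h1 (by nlinarith : 0 ≤ y ^ 2 - 1)]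
  calc Real.log (Real.exp 1 + a p α x) ≤ Real.log (y ^ (p + |α| + 2)) :=
        Real.log_le_log (by positivity) hmul
    _ = _ := Real.log_rpow (by linarith) _

theorem eq_rpow_a_mul_log {p α x : ℝ} (hp : 0 < p) (hx : 0 ≤ x) :
    x = a p α x ^ (1 / p) * Real.log (Real.exp 1 + x) ^ (α / p) := by
  have hL : 0 < Real.log (Real.exp 1 + x) := by linarith [one_le_log_exp_one_add hx]
  unfold a
  rw [Real.div_rpow (by positivity) (by positivity), ← Real.rpow_mul hx, ← Real.rpow_mul hL.le,
    mul_one_div_cancel hp.ne', Real.rpow_one, mul_one_div,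
    div_mul_cancel₀ _ (Real.rpow_pos_of_pos hL _).ne']

theorem log_le_log_a {p α x : ℝ} (hp : 0 < p) (hα : α ≤ p) (hx : 0 ≤ x) :
    Real.log (Real.exp 1 + x) ≤ 2 * (1 / p + 3) * Real.log (Real.exp 1 + a p α x) := by
  have he : 2 ≤ Real.exp 1 := by linarith [Real.add_one_le_exp (1 : ℝ)]
  have hL := one_le_log_exp_one_add hx
  have hxe := eq_rpow_a_mul_log (α := α) hp hx
  have ha0 : 0 ≤ a p α x := by unfold a; positivity
  set s := a p α x
  set S := s ^ (1 / p)
  have hS0 : 0 ≤ S := by positivity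
  set r := √(Real.exp 1 + x) with hr
  have hrr : r ^ 2 = Real.exp 1 + x := Real.sq_sqrt (by positivity)
  have hr1 : 1 ≤ r := by rw [hr, Real.one_le_sqrt]; linarith
  have hlog : Real.log (Real.exp 1 + x) = 2 * Real.log r := by
    rw [← hrr, Real.log_pow]; norm_num
  have hxS : x ≤ S * (2 * r) := by
    calc x = S * Real.log (Real.exp 1 + x) ^ (α / p) := hxe
      _ ≤ S * Real.log (Real.exp 1 + x) ^ (1 : ℝ) := by
          gcongr
          exact (div_le_one hp).2 hα
      _ ≤ S * (2 * r) := by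
          rw [Real.rpow_one, hlog]
          gcongr
          exact Real.log_le_self (by linarith)
  have hrS : r ≤ Real.exp 1 + 2 * S := by
    by_contra! h
    nlinarith
  set w := Real.exp 1 + s
  have hw2 : 2 ≤ w := by linarith
  have hSw : S ≤ w ^ (1 / p) := Real.rpow_le_rpow ha0 (by linarith) (by positivity)
  have hw1 : 1 ≤ w ^ (1 / p) := Real.one_le_rpow (by linarith) (by positivity)
  have hrw : r ≤ w ^ (1 / p + 3) := by
    rw [Real.rpow_add (by linarith : 0 < w)]
    norm_cast
    have hw3 : w + 2 ≤ w ^ 3 := by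
      nlinarith [sq_nonneg w, mul_nonneg (sub_nonneg.2 hw2) (sq_nonneg w)]
    nlinarith [mul_le_mul_of_nonneg_left hw3 (by linarith : 0 ≤ w ^ (1 / p)),
      mul_le_mul_of_nonneg_left hw1 (by linarith : 0 ≤ w)]
  rw [hlog, mul_assoc, ← Real.log_rpow (by linarith : 0 < w)]
  gcongr

/-- For p > 0 and α ≤ p, there exist constants C₁, C₂ > 0 depending
only on p and α such that C₁ t^{(p+1)/p}(log(e+t))^{α/p} ≤ Ã(t) ≤
C₂ t^{(p+1)/p}(log(e+t))^{α/p} for all t ≥ 0. -/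
theorem Atilde_bounds (p α : ℝ) (hp : 0 < p) (hα : α ≤ p)
    (atil : ℝ → ℝ) (hmaps : Set.MapsTo atil (Set.Ici 0) (Set.Ici 0))
    (hinv : Set.InvOn atil (a p α) (Set.Ici 0) (Set.Ici 0)) :
    ∃ C₁ C₂ : ℝ, 0 < C₁ ∧ 0 < C₂ ∧ ∀ t : ℝ, 0 ≤ t →
      C₁ * t ^ ((p + 1) / p) * Real.log (Real.exp 1 + t) ^ (α / p) ≤ Atilde atil t ∧
      Atilde atil t ≤ C₂ * t ^ ((p + 1) / p) * Real.log (Real.exp 1 + t) ^ (α / p) := by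
  have hmono : MonotoneOn atil (Set.Ici 0) := by
    intro s hs t ht hst
    by_contra! h
    have h1 := a_monotoneOn hp hα (hmaps ht) (hmaps hs) h.le
    rw [hinv.2 hs, hinv.2 ht] at h1
    rw [le_antisymm hst h1] at h
    exact lt_irrefl _ h
  have hL : ∀ {s : ℝ}, 0 ≤ s → 0 < Real.log (Real.exp 1 + s) := fun hs => by
    linarith [one_le_log_exp_one_add hs]
  obtain ⟨k, hk, hbounds⟩ : ∃ k : ℝ, 0 < k ∧ ∀ s : ℝ, 0 ≤ s →
      s ^ (1 / p) * Real.log (Real.exp 1 + s) ^ (α / p) ≤ k * atil s ∧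
      atil s ≤ k * (s ^ (1 / p) * Real.log (Real.exp 1 + s) ^ (α / p)) := by
    set c := max (p + |α| + 2) (2 * (1 / p + 3))
    have hc0 : 0 < c := lt_max_of_lt_left (by positivity)
    refine ⟨c ^ |α / p|, by positivity, fun s hs => ?_⟩
    have hx : 0 ≤ atil s := hmaps hs
    have h1 := log_a_le (α := α) hp hx
    have h2 := log_le_log_a hp hα hx
    have h3 := eq_rpow_a_mul_log (α := α) hp hx
    rw [hinv.2 hs] at h1 h2 h3
    replace h1 := h1.trans (mul_le_mul_of_nonneg_right (le_max_left _ _ : _ ≤ c) (hL hx).le)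
    replace h2 := h2.trans (mul_le_mul_of_nonneg_right (le_max_right _ _ : _ ≤ c) (hL hs).le)
    have h4 := rpow_le_of_comparable (α / p) (hL hs) (hL hx) hc0 h1 h2
    have h5 := rpow_le_of_comparable (α / p) (hL hx) (hL hs) hc0 h2 h1
    have hs' : 0 ≤ s ^ (1 / p) := by positivity
    constructor
    · calc _ ≤ s ^ (1 / p) * (c ^ |α / p| * Real.log (Real.exp 1 + atil s) ^ (α / p)) := by
            gcongr
        _ = c ^ |α / p| * (s ^ (1 / p) * Real.log (Real.exp 1 + atil s) ^ (α / p)) := by ring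
        _ = c ^ |α / p| * atil s := by rw [← h3]
    · calc atil s = s ^ (1 / p) * Real.log (Real.exp 1 + atil s) ^ (α / p) := h3
        _ ≤ s ^ (1 / p) * (c ^ |α / p| * Real.log (Real.exp 1 + s) ^ (α / p)) := by gcongr
        _ = _ := by ring
  have hint : ∀ {u v : ℝ}, 0 ≤ u → u ≤ v → IntervalIntegrable atil MeasureTheory.volume u v :=
    fun hu huv => (hmono.mono fun z hz => by
      rw [Set.uIcc_of_le huv] at hz
      exact hu.trans hz.1).intervalIntegrable
  have hpow : ∀ {t : ℝ}, 0 ≤ t → t ^ ((p + 1) / p) = t * t ^ (1 / p) := fun {t} ht => by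
    rw [show (p + 1) / p = 1 + 1 / p by field_simp, Real.rpow_add_of_nonneg ht (by norm_num)
      (by positivity), Real.rpow_one]
  refine ⟨(1 / 2) ^ ((p + 1) / p) / (k * 2 ^ |α / p|), k, by positivity, hk, fun t ht => ⟨?_, ?_⟩⟩
  · have ht2 : 0 ≤ t / 2 := by linarith
    have hint1 := hint le_rfl ht2
    have hint2 := hint ht2 (by linarith : t / 2 ≤ t)
    have hlower : t / 2 * atil (t / 2) ≤ Atilde atil t := by
      have h1 : 0 ≤ ∫ s in (0 : ℝ)..(t / 2), atil s :=
        intervalIntegral.integral_nonneg ht2 fun s hs => hmaps hs.1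
      have h2 : ∫ s in (t / 2)..t, atil (t / 2) ≤ ∫ s in (t / 2)..t, atil s :=
        intervalIntegral.integral_mono_on (by linarith) (by simp) hint2 fun s hs =>
          hmono ht2 (ht2.trans hs.1) hs.1
      rw [intervalIntegral.integral_const, smul_eq_mul] at h2
      unfold Atilde
      rw [← intervalIntegral.integral_add_adjacent_intervals hint1 hint2]
      linarith
    have hlog : Real.log (Real.exp 1 + t) ≤ 2 * Real.log (Real.exp 1 + t / 2) := by
      have h1 : Real.exp 1 + t ≤ (Real.exp 1 + t / 2) ^ 2 := by
        nlinarith [Real.add_one_le_exp (1 : ℝ)]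
      have h2 := Real.log_le_log (by positivity) h1
      rwa [Real.log_pow, Nat.cast_ofNat] at h2
    have hcomp := rpow_le_of_comparable (α / p) (hL ht) (hL ht2) two_pos hlog
      (by linarith [log_exp_one_add_mono ht2 (by linarith : t / 2 ≤ t), hL ht])
    refine le_trans ?_ hlower
    have hLt2 := hL ht2
    rw [div_mul_eq_mul_div, div_mul_eq_mul_div, div_le_iff₀ (by positivity),
      ← Real.mul_rpow (by norm_num) ht, one_div_mul_eq_div, hpow ht2]
    calc t / 2 * (t / 2) ^ (1 / p) * Real.log (Real.exp 1 + t) ^ (α / p)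
        ≤ t / 2 * (t / 2) ^ (1 / p) *
          (2 ^ |α / p| * Real.log (Real.exp 1 + t / 2) ^ (α / p)) := by gcongr
      _ = t / 2 * 2 ^ |α / p| *
          ((t / 2) ^ (1 / p) * Real.log (Real.exp 1 + t / 2) ^ (α / p)) := by ring
      _ ≤ t / 2 * 2 ^ |α / p| * (k * atil (t / 2)) := by
          exact mul_le_mul_of_nonneg_left (hbounds _ ht2).1 (by positivity)
      _ = _ := by ring
  · have h : Atilde atil t ≤ ∫ s in (0 : ℝ)..t, atil t :=
      intervalIntegral.integral_mono_on ht (hint le_rfl ht) (by simp) fun s hs =>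
        hmono hs.1 ht hs.2
    rw [intervalIntegral.integral_const, smul_eq_mul, sub_zero] at h
    calc Atilde atil t ≤ t * atil t := h
      _ ≤ t * (k * (t ^ (1 / p) * Real.log (Real.exp 1 + t) ^ (α / p))) := by
          gcongr
          exact (hbounds t ht).2
      _ = _ := by rw [hpow ht]; ring
end

section
/- Let p > 0 and α ≤ p. Then lim_{t→∞} t·ã(t) / Ã(t) = (p+1)/p. -/
open Real Set Filter Topology

lemma exp_one_add_gt_one {t : ℝ} (ht : 0 ≤ t) : 1 < Real.exp 1 + t := by
  linarith [Real.add_one_lt_exp (one_ne_zero (α := ℝ))]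

lemma log_exp_one_add_pos {t : ℝ} (ht : 0 ≤ t) : 0 < Real.log (Real.exp 1 + t) :=
  Real.log_pos (exp_one_add_gt_one ht)

lemma a_nonneg (p α : ℝ) {t : ℝ} (ht : 0 ≤ t) : 0 ≤ a p α t :=
  div_nonneg (Real.rpow_nonneg ht _) (Real.rpow_nonneg (log_exp_one_add_pos ht).le _)

lemma a_zero {p : ℝ} (hp : 0 < p) (α : ℝ) : a p α 0 = 0 := by
  simp [a, Real.zero_rpow hp.ne']

lemma a_pos (p α : ℝ) {t : ℝ} (ht : 0 < t) : 0 < a p α t :=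
  div_pos (Real.rpow_pos_of_pos ht _) (Real.rpow_pos_of_pos (log_exp_one_add_pos ht.le) _)

lemma continuousOn_a {p : ℝ} (hp : 0 < p) (α : ℝ) : ContinuousOn (a p α) (Ici 0) := by
  refine ContinuousOn.div (continuousOn_id.rpow_const fun x _ => Or.inr hp.le) ?_ ?_
  · refine ContinuousOn.rpow_const (ContinuousOn.log (by fun_prop) ?_) ?_
    · exact fun x hx => (zero_lt_one.trans (exp_one_add_gt_one hx)).ne'
    · exact fun x hx => Or.inl (log_exp_one_add_pos hx).ne'
  · exact fun x hx => (Real.rpow_pos_of_pos (log_exp_one_add_pos hx) _).ne'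

/-- If `a` is injective on `[0, ∞)`, then it is strictly increasing there. -/
lemma strictMonoOn_a {p α : ℝ} (hp : 0 < p) (h : InjOn (a p α) (Ici 0)) :
    StrictMonoOn (a p α) (Ici 0) := by
  intro x hx y hy hxy
  have hy0 : (0 : ℝ) ≤ y := hy
  have hsub : Icc 0 y ⊆ Ici (0 : ℝ) := Icc_subset_Ici_self
  exact ContinuousOn.strictMonoOn_of_injOn_Icc hy0 (by rw [a_zero hp]; exact a_nonneg p α hy0)
    ((continuousOn_a hp α).mono hsub) (h.mono hsub) ⟨hx, hxy.le⟩ ⟨hy0, le_rfl⟩ hxy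

lemma tendsto_log_exp_one_add_mul_div {c : ℝ} (hc : 0 < c) :
    Tendsto (fun v : ℝ => Real.log (Real.exp 1 + c * v) / Real.log (Real.exp 1 + v))
      atTop (𝓝 1) := by
  have hadd : Tendsto (fun v : ℝ => Real.exp 1 + v) atTop atTop :=
    tendsto_atTop_add_const_left _ _ tendsto_id
  have hlog : Tendsto (fun v : ℝ => Real.log (Real.exp 1 + v)) atTop atTop :=
    Real.tendsto_log_atTop.comp hadd
  have hquot : Tendsto (fun v : ℝ => c + (Real.exp 1 - c * Real.exp 1) / (Real.exp 1 + v))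
      atTop (𝓝 c) := by
    simpa using (hadd.const_div_atTop (Real.exp 1 - c * Real.exp 1)).const_add c
  have h := ((hquot.log hc.ne').div_atTop hlog).const_add 1
  rw [add_zero] at h
  refine h.congr' ?_
  filter_upwards [eventually_ge_atTop 0] with v hv
  have h1 : 0 < Real.exp 1 + v := zero_lt_one.trans (exp_one_add_gt_one hv)
  have h2 : 0 < Real.exp 1 + c * v :=
    zero_lt_one.trans (exp_one_add_gt_one (mul_nonneg hc.le hv))
  have h3 := log_exp_one_add_pos hv
  have h4 : c + (Real.exp 1 - c * Real.exp 1) / (Real.exp 1 + v)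
      = (Real.exp 1 + c * v) / (Real.exp 1 + v) := by
    field_simp
    ring
  rw [h4, Real.log_div h2.ne' h1.ne']
  field_simp
  ring

/-- The function `a` is regularly varying at infinity with index `p`. -/
lemma tendsto_a_mul_div_a (p α : ℝ) {c : ℝ} (hc : 0 < c) :
    Tendsto (fun v : ℝ => a p α (c * v) / a p α v) atTop (𝓝 (c ^ p)) := by
  have h := (tendsto_const_nhds (x := c ^ p)).div
    ((tendsto_log_exp_one_add_mul_div hc).rpow_const (p := α) (Or.inl one_ne_zero)) (by simp)
  rw [Real.one_rpow, div_one] at h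
  refine h.congr' ?_
  filter_upwards [eventually_gt_atTop 0] with v hv
  have h1 := log_exp_one_add_pos hv.le
  have h2 := log_exp_one_add_pos (mul_pos hc hv).le
  have h3 := Real.rpow_pos_of_pos h1 α
  have h4 := Real.rpow_pos_of_pos h2 α
  have h5 := Real.rpow_pos_of_pos hv p
  rw [a, a, Pi.div_apply, Real.mul_rpow hc.le hv.le, Real.div_rpow h2.le h1.le]
  field_simp

section Inverse

variable {p α : ℝ} {atil : ℝ → ℝ}

lemma strictMonoOn_atil (hp : 0 < p) (hmaps : MapsTo atil (Ici 0) (Ici 0))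
    (hinv : InvOn atil (a p α) (Ici 0) (Ici 0)) : StrictMonoOn atil (Ici 0) := by
  intro x hx y hy hxy
  rw [← (strictMonoOn_a hp hinv.1.injOn).lt_iff_lt (hmaps hx) (hmaps hy), hinv.2 hx, hinv.2 hy]
  exact hxy

lemma atil_pos (hp : 0 < p) (hmaps : MapsTo atil (Ici 0) (Ici 0))
    (hinv : InvOn atil (a p α) (Ici 0) (Ici 0)) {t : ℝ} (ht : 0 < t) : 0 < atil t :=
  lt_of_le_of_lt (hmaps self_mem_Ici)
    (strictMonoOn_atil hp hmaps hinv self_mem_Ici ht.le ht)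

lemma tendsto_atil_atTop (hp : 0 < p) (hmaps : MapsTo atil (Ici 0) (Ici 0))
    (hinv : InvOn atil (a p α) (Ici 0) (Ici 0)) : Tendsto atil atTop atTop := by
  refine tendsto_atTop.2 fun M => ?_
  have hM : 0 ≤ max M 0 := le_max_right _ _
  have haM := a_nonneg p α hM
  filter_upwards [eventually_ge_atTop (a p α (max M 0))] with t ht
  calc M ≤ max M 0 := le_max_left _ _
    _ = atil (a p α (max M 0)) := (hinv.1 hM).symm
    _ ≤ atil t := (strictMonoOn_atil hp hmaps hinv).monotoneOn haM (haM.trans ht) ht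

/-- The inverse of `a` is regularly varying at infinity with index `1 / p`. -/
lemma tendsto_atil_mul_div_atil (hp : 0 < p) (hmaps : MapsTo atil (Ici 0) (Ici 0))
    (hinv : InvOn atil (a p α) (Ici 0) (Ici 0)) {x : ℝ} (hx : 0 < x) :
    Tendsto (fun t : ℝ => atil (t * x) / atil t) atTop (𝓝 (x ^ (1 / p))) := by
  have hmono := strictMonoOn_a hp hinv.1.injOn
  have hratio {c : ℝ} (hc : 0 < c) :=
    (tendsto_a_mul_div_a p α hc).comp (tendsto_atil_atTop hp hmaps hinv)
  have hpow : (x ^ (1 / p)) ^ p = x := by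
    rw [← Real.rpow_mul hx.le, one_div_mul_cancel hp.ne', Real.rpow_one]
  have hroot : 0 < x ^ (1 / p) := Real.rpow_pos_of_pos hx _
  refine tendsto_order.2 ⟨fun b hb => ?_, fun b hb => ?_⟩
  · obtain ⟨c, hbc, hcx⟩ := exists_between (max_lt hb hroot)
    have hc : 0 < c := (le_max_right _ _).trans_lt hbc
    have hcp : c ^ p < x := hpow ▸ Real.rpow_lt_rpow hc.le hcx hp
    filter_upwards [(hratio hc).eventually_lt_const hcp, eventually_gt_atTop 0] with t h ht
    have hpos := atil_pos hp hmaps hinv ht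
    have htx : 0 ≤ t * x := (mul_pos ht hx).le
    rw [Function.comp_apply, div_lt_iff₀ (a_pos p α hpos), hinv.2 ht.le, mul_comm x,
      ← hinv.2 htx, hmono.lt_iff_lt (mul_pos hc hpos).le (hmaps htx)] at h
    exact ((le_max_left _ _).trans_lt hbc).trans ((lt_div_iff₀ hpos).2 h)
  · have hb0 : 0 < b := hroot.trans hb
    have hbp : x < b ^ p := by
      conv_lhs => rw [← hpow]
      exact Real.rpow_lt_rpow hroot.le hb hp
    filter_upwards [(hratio hb0).eventually_const_lt hbp, eventually_gt_atTop 0] with t h ht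
    have hpos := atil_pos hp hmaps hinv ht
    have htx : 0 ≤ t * x := (mul_pos ht hx).le
    rw [Function.comp_apply, lt_div_iff₀ (a_pos p α hpos), hinv.2 ht.le, mul_comm x,
      ← hinv.2 htx, hmono.lt_iff_lt (hmaps htx) (mul_pos hb0 hpos).le] at h
    exact (div_lt_iff₀ hpos).2 h

lemma tendsto_integral_atil_mul_div_atil (hp : 0 < p) (hmaps : MapsTo atil (Ici 0) (Ici 0))
    (hinv : InvOn atil (a p α) (Ici 0) (Ici 0)) :
    Tendsto (fun t : ℝ => ∫ x in (0 : ℝ)..1, atil (t * x) / atil t) atTop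
      (𝓝 (∫ x in (0 : ℝ)..1, x ^ (1 / p))) := by
  have hmono := (strictMonoOn_atil hp hmaps hinv).monotoneOn
  refine intervalIntegral.tendsto_integral_filter_of_dominated_convergence (fun _ => 1) ?_ ?_
    intervalIntegrable_const ?_
  · filter_upwards [eventually_gt_atTop 0] with t ht
    rw [uIoc_of_le zero_le_one]
    refine (aemeasurable_restrict_of_monotoneOn measurableSet_Ioc ?_).aestronglyMeasurable
    intro x hx y hy hxy
    exact div_le_div_of_nonneg_right (hmono (mul_pos ht hx.1).le (mul_pos ht hy.1).le
      (mul_le_mul_of_nonneg_left hxy ht.le)) (hmaps ht.le)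
  · filter_upwards [eventually_gt_atTop 0] with t ht
    refine Eventually.of_forall fun x hx => ?_
    rw [uIoc_of_le zero_le_one] at hx
    have htx : 0 ≤ t * x := (mul_pos ht hx.1).le
    rw [Real.norm_of_nonneg (div_nonneg (hmaps htx) (hmaps ht.le)),
      div_le_one (atil_pos hp hmaps hinv ht)]
    exact hmono htx ht.le (mul_le_of_le_one_right ht.le hx.2)
  · refine Eventually.of_forall fun x hx => ?_
    rw [uIoc_of_le zero_le_one] at hx
    exact tendsto_atil_mul_div_atil hp hmaps hinv hx.1

end Inverse

/-- For p > 0 and α ≤ p, lim_{t→∞} t·ã(t)/Ã(t) = (p+1)/p. -/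
theorem tAtil_over_Atilde_limit (p α : ℝ) (hp : 0 < p) (hα : α ≤ p)
    (atil : ℝ → ℝ) (hmaps : Set.MapsTo atil (Set.Ici 0) (Set.Ici 0))
    (hinv : Set.InvOn atil (a p α) (Set.Ici 0) (Set.Ici 0)) :
    Tendsto (fun t : ℝ => t * atil t / Atilde atil t) atTop (nhds ((p + 1) / p)) := by
  have h := tendsto_integral_atil_mul_div_atil hp hmaps hinv
  have hp' : 0 < 1 / p := one_div_pos.2 hp
  have hval : ∫ x in (0 : ℝ)..1, x ^ (1 / p) = p / (p + 1) := by
    rw [integral_rpow (Or.inl (by linarith)), Real.one_rpow, Real.zero_rpow (by positivity)]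
    field_simp
    ring
  rw [hval] at h
  have h' := h.inv₀ (by positivity)
  rw [inv_div] at h'
  refine h'.congr' ?_
  filter_upwards [eventually_gt_atTop 0] with t ht
  rw [intervalIntegral.integral_div, intervalIntegral.integral_comp_mul_left _ ht.ne',
    mul_zero, mul_one, smul_eq_mul, ← Atilde, inv_div, div_mul_eq_div_div, div_inv_eq_mul,
    mul_comm]
end
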